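/- Let b_n(x) be defined by b_{n+1}(x) = x b_n(x) - b_{n-1}(x), b_{-1} = 0, b_0 = 1 (monic Chebyshev on [-2,2]). For |y| ≤ 2 and |x| ≤ 2, x ≠ y when ρ-degenerate, the identity (x² + Dx + E)·1 = (b_2(x) + κ b_1(x) + λ) + (D + κ)(b_1(x)) + (E + 1 + Dκ + λ)·something reduces to: b_2(x) - ρy b_1(x) + ρ² = x² - ρ y x + ρ² - 1, and integrating against the Kesten–McKay density gives ∫_{-2}^{2} (x² - ρyx + ρ² - 1) f(x;y,ρ) dx = 0, i.e., the quasi-orthogonal polynomial a_2(x) = b_2(x) - ρy b_1(x) + ρ² has zero mean under the Kesten–McKay measure. -/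

import Mathlib

open Real

lemma aux_Q_pos (ρ x y : ℝ) (hx : |x| ≤ 2) (hy : |y| ≤ 2) (hρ1 : |ρ| < 1) :
    0 < (1 - ρ ^ 2) ^ 2 - ρ * (1 + ρ ^ 2) * x * y + ρ ^ 2 * (x ^ 2 + y ^ 2) := by
  have hxy : |x * y| ≤ 4 := by
    rw [abs_mul]; nlinarith [abs_nonneg x, abs_nonneg y]
  obtain ⟨h1, h2⟩ := abs_le.1 hxy
  obtain ⟨h3, h4⟩ := abs_lt.1 hρ1
  rcases le_total 0 ρ with h | h
  · have e : (1 - ρ ^ 2) ^ 2 - ρ * (1 + ρ ^ 2) * x * y + ρ ^ 2 * (x ^ 2 + y ^ 2)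
        = (1 - ρ) ^ 2 * ((1 - ρ) ^ 2 + ρ * (4 - x * y)) + (ρ * (x - y)) ^ 2 := by ring
    have a : 0 < 1 - ρ := by linarith
    have b : 0 ≤ 4 - x * y := by linarith
    rw [e]; positivity
  · have e : (1 - ρ ^ 2) ^ 2 - ρ * (1 + ρ ^ 2) * x * y + ρ ^ 2 * (x ^ 2 + y ^ 2)
        = (1 + ρ) ^ 2 * ((1 + ρ) ^ 2 + (-ρ) * (4 + x * y)) + (ρ * (x + y)) ^ 2 := by ring
    have a : 0 < 1 + ρ := by linarith
    have b : 0 ≤ 4 + x * y := by linarith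
    have c : 0 ≤ -ρ := by linarith
    rw [e]; positivity

lemma aux_D_ne (ρ y : ℝ) (hy : |y| ≤ 2) (hρ1 : |ρ| < 1) (z : ℂ) (hz : ‖z‖ ≤ 1) :
    1 - ρ * y * z + ρ ^ 2 * z ^ 2 ≠ 0 := by
  obtain ⟨h1, h2⟩ := abs_le.1 hy
  have hc : Real.cos (Real.arccos (y / 2)) = y / 2 :=
    Real.cos_arccos (by linarith) (by linarith)
  set φ := Real.arccos (y / 2)
  have key : ∀ t : ℝ, 1 - ρ * Complex.exp (t * Complex.I) * z ≠ 0 := by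
    intro t h
    have h' : (ρ * Complex.exp (t * Complex.I) * z) = 1 := by linear_combination -h
    have := congrArg norm h'
    rw [norm_mul, norm_mul, Complex.norm_exp_ofReal_mul_I, Complex.norm_real, norm_one,
      Real.norm_eq_abs] at this
    nlinarith [norm_nonneg z, abs_nonneg ρ]
  have hcc : Complex.exp (φ * Complex.I) + Complex.exp ((-φ : ℝ) * Complex.I) = y := by
    have : (y : ℂ) = 2 * Complex.cos φ := by
      rw [← Complex.ofReal_cos, hc]; push_cast; ring
    rw [this, Complex.two_cos]; push_cast; rfl
  have hm : Complex.exp (φ * Complex.I) * Complex.exp ((-φ : ℝ) * Complex.I) = 1 := by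
    rw [← Complex.exp_add]; push_cast; simp
  have := mul_ne_zero (key φ) (key (-φ))
  convert this using 1
  rw [← hcc]
  linear_combination (-ρ ^ 2 * z ^ 2 : ℂ) * hm

/-- the analytic function whose real part is half the integrand -/
noncomputable def auxH (ρ y : ℝ) (z : ℂ) : ℂ :=
  z ^ 2 - 1 + (1 - z ^ 2) * (1 - ρ * y * z + z ^ 2) / (1 - ρ * y * z + ρ ^ 2 * z ^ 2)

/-- the trigonometric integrand -/
noncomputable def auxK (ρ y θ : ℝ) : ℝ :=
  ((2 * cos θ) ^ 2 - ρ * y * (2 * cos θ) + ρ ^ 2 - 1) * ((1 - ρ ^ 2) * (4 * sin θ ^ 2) /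
    ((1 - ρ ^ 2) ^ 2 - ρ * (1 + ρ ^ 2) * (2 * cos θ) * y + ρ ^ 2 * ((2 * cos θ) ^ 2 + y ^ 2)))

lemma aux_alg (r y z w Q x S : ℂ) (h : z * w = 1) (hx : x = z + w) (hS : S = -(z - w) ^ 2)
    (hQ : Q = (1 - r ^ 2) ^ 2 - r * (1 + r ^ 2) * x * y + r ^ 2 * (x ^ 2 + y ^ 2))
    (hz : 1 - r * y * z + r ^ 2 * z ^ 2 ≠ 0) (hw : 1 - r * y * w + r ^ 2 * w ^ 2 ≠ 0) :
    (x ^ 2 - r * y * x + r ^ 2 - 1) * ((1 - r ^ 2) * S / Q) =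
    (z ^ 2 - 1 + (1 - z ^ 2) * (1 - r * y * z + z ^ 2) / (1 - r * y * z + r ^ 2 * z ^ 2)) +
    (w ^ 2 - 1 + (1 - w ^ 2) * (1 - r * y * w + w ^ 2) / (1 - r * y * w + r ^ 2 * w ^ 2)) := by
  have hQ' : Q = (1 - r * y * z + r ^ 2 * z ^ 2) * (1 - r * y * w + r ^ 2 * w ^ 2) := by
    rw [hQ, hx]; grind
  have hz0 : z ≠ 0 := by rintro rfl; simp at h
  have hw' : w = z⁻¹ := eq_inv_of_mul_eq_one_right h
  have e1 : (1 - z ^ 2) * (1 - r * y * z + z ^ 2) / (1 - r * y * z + r ^ 2 * z ^ 2) =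
      (x ^ 2 - r * y * x + r ^ 2 - 1) * ((1 - z ^ 2) / (1 - r * y * z + r ^ 2 * z ^ 2))
        - (w ^ 2 - 1) := by
    rw [mul_div_assoc', eq_sub_iff_add_eq, div_add' _ _ _ hz]
    congr 1
    rw [hx]; grind
  have e2 : (1 - w ^ 2) * (1 - r * y * w + w ^ 2) / (1 - r * y * w + r ^ 2 * w ^ 2) =
      (x ^ 2 - r * y * x + r ^ 2 - 1) * ((1 - w ^ 2) / (1 - r * y * w + r ^ 2 * w ^ 2))
        - (z ^ 2 - 1) := by
    rw [mul_div_assoc', eq_sub_iff_add_eq, div_add' _ _ _ hw]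
    congr 1
    rw [hx]; grind
  have e3 : (1 - r ^ 2) * S / Q = (1 - z ^ 2) / (1 - r * y * z + r ^ 2 * z ^ 2) +
      (1 - w ^ 2) / (1 - r * y * w + r ^ 2 * w ^ 2) := by
    rw [div_add_div _ _ hz hw, hQ', hS]
    congr 1
    grind
  rw [e1, e2, e3]; ring

lemma auxK_eq (ρ y : ℝ) (hy : |y| ≤ 2) (hρ1 : |ρ| < 1) (θ : ℝ) :
    auxK ρ y θ = 2 * (auxH ρ y (circleMap 0 1 θ)).re := by
  have hz : circleMap 0 1 θ = Complex.exp (θ * Complex.I) := by simp [circleMap]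
  rw [hz]
  have hn : ‖Complex.exp (θ * Complex.I)‖ ≤ 1 := (Complex.norm_exp_ofReal_mul_I θ).le
  have hconj : (starRingEnd ℂ) (Complex.exp (θ * Complex.I)) = Complex.exp (-θ * Complex.I) := by
    rw [← Complex.exp_conj]; simp
  have hn' : ‖Complex.exp (-θ * Complex.I)‖ ≤ 1 := by rw [← hconj, Complex.norm_conj]; exact hn
  have hH : (starRingEnd ℂ) (auxH ρ y (Complex.exp (θ * Complex.I))) =
      auxH ρ y (Complex.exp (-θ * Complex.I)) := by
    rw [← hconj]; simp [auxH]
  have h2 := Complex.add_conj (auxH ρ y (Complex.exp (θ * Complex.I)))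
  rw [hH] at h2
  apply Complex.ofReal_injective
  rw [← h2]
  have hm : Complex.exp (θ * Complex.I) * Complex.exp (-θ * Complex.I) = 1 := by
    rw [← Complex.exp_add]; simp
  have hc := Complex.two_cos (θ : ℂ)
  have hs : (4 * Complex.sin θ ^ 2 : ℂ)
      = -(Complex.exp (θ * Complex.I) - Complex.exp (-θ * Complex.I)) ^ 2 := by
    have := Complex.two_sin (θ : ℂ)
    have h4 : (4 * Complex.sin θ ^ 2 : ℂ) = (2 * Complex.sin θ) ^ 2 := by ring
    rw [h4, this, mul_pow, Complex.I_sq]; ring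
  have := aux_alg ρ y _ _ _ _ _ hm hc hs rfl (aux_D_ne ρ y hy hρ1 _ hn)
    (aux_D_ne ρ y hy hρ1 _ hn')
  rw [auxH, auxH, ← this, auxK]
  push_cast
  rfl

lemma aux_cont_H (ρ y : ℝ) (hy : |y| ≤ 2) (hρ1 : |ρ| < 1) :
    DiffContOnCl ℂ (auxH ρ y) (Metric.ball 0 1) := by
  apply DifferentiableOn.diffContOnCl
  rw [closure_ball _ one_ne_zero]
  intro z hz
  have hz' : ‖z‖ ≤ 1 := by simpa using hz
  have := aux_D_ne ρ y hy hρ1 z hz'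
  unfold auxH
  apply DifferentiableAt.differentiableWithinAt
  fun_prop (disch := assumption)

lemma aux_cont_H' (ρ y : ℝ) (hy : |y| ≤ 2) (hρ1 : |ρ| < 1) :
    Continuous (fun θ => auxH ρ y (circleMap 0 1 θ)) := by
  have : ∀ θ, (1 - ρ * y * (circleMap 0 1 θ) + ρ ^ 2 * (circleMap 0 1 θ) ^ 2 : ℂ) ≠ 0 :=
    fun θ => aux_D_ne ρ y hy hρ1 _ (by simp)
  unfold auxH
  have hc := continuous_circleMap 0 1
  fun_prop (disch := assumption)

lemma aux_full (ρ y : ℝ) (hy : |y| ≤ 2) (hρ1 : |ρ| < 1) :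
    ∫ θ in (0 : ℝ)..(2 * π), auxK ρ y θ = 0 := by
  have h0 : ∫ θ in (0 : ℝ)..(2 * π), auxH ρ y (circleMap 0 1 θ) = 0 := by
    have := DiffContOnCl.circleAverage (f := auxH ρ y) (c := 0) (R := 1)
      (by simpa using aux_cont_H ρ y hy hρ1)
    rw [Real.circleAverage_def] at this
    have h : auxH ρ y 0 = 0 := by simp [auxH]
    rw [h, smul_eq_zero] at this
    rcases this with h | h
    · exact absurd h (by positivity)
    · exact h
  simp_rw [auxK_eq ρ y hy hρ1]
  rw [intervalIntegral.integral_const_mul]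
  have := Complex.reCLM.intervalIntegral_comp_comm
    ((aux_cont_H' ρ y hy hρ1).intervalIntegrable (μ := MeasureTheory.volume) 0 (2 * π))
  rw [h0] at this
  simp only [Complex.reCLM_apply] at this
  rw [this]; simp

lemma aux_half (ρ y : ℝ) (hy : |y| ≤ 2) (hρ1 : |ρ| < 1) :
    ∫ θ in (0 : ℝ)..π, auxK ρ y θ = 0 := by
  have hc : Continuous (auxK ρ y) := by
    have : auxK ρ y = fun θ => 2 * (auxH ρ y (circleMap 0 1 θ)).re :=
      funext (auxK_eq ρ y hy hρ1)
    rw [this]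
    exact continuous_const.mul (Complex.continuous_re.comp (aux_cont_H' ρ y hy hρ1))
  have h1 := aux_full ρ y hy hρ1
  rw [← intervalIntegral.integral_add_adjacent_intervals (b := π)
    (hc.intervalIntegrable _ _) (hc.intervalIntegrable _ _)] at h1
  have h2 := intervalIntegral.integral_comp_sub_left (a := 0) (b := π) (auxK ρ y) (2 * π)
  have h3 : ∀ θ, auxK ρ y (2 * π - θ) = auxK ρ y θ := by
    intro θ
    simp [auxK, Real.cos_two_pi_sub, Real.sin_two_pi_sub]
  simp_rw [h3] at h2
  rw [show 2 * π - π = π by ring, sub_zero] at h2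
  linarith

/-- The quasi-orthogonal polynomial `a_2(x) = x² - ρyx + ρ² - 1` has zero mean under
the Kesten–McKay density. -/
theorem stmt_15 (ρ y : ℝ) (hy : |y| ≤ 2) (hρ0 : 0 < |ρ|) (hρ1 : |ρ| < 1) :
    ∫ x in (-2 : ℝ)..2,
      (x ^ 2 - ρ * y * x + ρ ^ 2 - 1) *
        ((1 - ρ ^ 2) * Real.sqrt (4 - x ^ 2) /
          (2 * π * ((1 - ρ ^ 2) ^ 2 - ρ * (1 + ρ ^ 2) * x * y + ρ ^ 2 * (x ^ 2 + y ^ 2)))) =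
      0 := by
  set F : ℝ → ℝ := fun x => (x ^ 2 - ρ * y * x + ρ ^ 2 - 1) *
        ((1 - ρ ^ 2) * Real.sqrt (4 - x ^ 2) /
          (2 * π * ((1 - ρ ^ 2) ^ 2 - ρ * (1 + ρ ^ 2) * x * y + ρ ^ 2 * (x ^ 2 + y ^ 2))))
    with hF
  have hcont : ContinuousOn F (Set.Icc (-2) 2) := by
    intro x hx
    have hp := (aux_Q_pos ρ x y (abs_le.2 hx) hy hρ1).ne'
    have hp' : 2 * π * ((1 - ρ ^ 2) ^ 2 - ρ * (1 + ρ ^ 2) * x * y + ρ ^ 2 * (x ^ 2 + y ^ 2)) ≠ 0 :=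
      mul_ne_zero (by positivity) hp
    apply ContinuousAt.continuousWithinAt
    rw [hF]
    fun_prop (disch := assumption)
  have hsub := intervalIntegral.integral_comp_mul_deriv'' (a := 0) (b := π)
    (f := fun θ => 2 * cos θ) (f' := fun θ => 2 * (-sin θ)) (g := F)
    (by fun_prop) (fun θ _ => ((Real.hasDerivAt_cos θ).const_mul 2).hasDerivWithinAt)
    (by fun_prop)
    (hcont.mono (by
      rintro _ ⟨θ, _, rfl⟩
      constructor
      · linarith [Real.neg_one_le_cos θ]
      · linarith [Real.cos_le_one θ]))
  simp only [Real.cos_zero, Real.cos_pi] at hsub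
  have hz : ∫ θ in (0 : ℝ)..π, (F ∘ fun θ => 2 * cos θ) θ * (2 * (-sin θ)) = 0 := by
    have : ∫ θ in (0 : ℝ)..π, (F ∘ fun θ => 2 * cos θ) θ * (2 * (-sin θ)) =
        ∫ θ in (0 : ℝ)..π, (-(2 * π)⁻¹) * auxK ρ y θ := by
      apply intervalIntegral.integral_congr
      intro θ hθ
      rw [Set.uIcc_of_le Real.pi_pos.le] at hθ
      have hs : Real.sqrt (4 - (2 * cos θ) ^ 2) = 2 * sin θ := by
        rw [show 4 - (2 * cos θ) ^ 2 = (2 * sin θ) ^ 2 by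
          nlinarith [Real.sin_sq_add_cos_sq θ]]
        exact Real.sqrt_sq (by linarith [Real.sin_nonneg_of_mem_Icc hθ])
      simp only [Function.comp, hF, auxK, hs]
      rw [mul_comm (2 * π), ← div_div, div_eq_mul_inv _ (2 * π)]
      ring
    rw [this, intervalIntegral.integral_const_mul, aux_half ρ y hy hρ1, mul_zero]
  rw [hz, intervalIntegral.integral_symm] at hsub
  norm_num at hsub
  exact hsub
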